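/- Let $k$ be a commutative ring, $G$ a group with a normal subgroup $H$, and $A$ a $k$-algebra with a $G/H$-grading $A=\bigoplus_{\bar g\in G/H}A_{\bar g}$ making $A$ a crossed product, with identity component $B:=A_{\bar 1}$. Suppose $B$ carries an $H$-grading $B=\bigoplus_{h\in H}B_h$ making $B$ a crossed product with identity component $C:=B_1$. Assume there is a family of invertible elements $a_x\in A^{\times}$ ($x\in G$) with $a_x\in A_{\bar x}$ such that: (1) $a_h\in B_h$ for all $h\in H$; (2) $a_xCa_x^{-1}=C$ for all $x\in G$; (3) $a_xa_ya_{xy}^{-1}\in C^{\times}$ for all $x,y\in G$. Then, setting $A_x:=C\cdot a_x$ for $x\in G$, the family $(A_x)_{x\in G}$ is a $G$-grading of $A$ (i.e. $A=\bigoplus_{x\in G}A_x$ and $A_xA_y\subseteq A_{xy}$) which refines the $G/H$-grading (i.e. $A_{\bar g}=\bigoplus_{x\in \bar g}A_x$ for every coset $\bar g$), satisfies $A_h=B_h$ for all $h\in H$, and makes $A$ a $G$-crossed product (each $A_x$ contains a unit of $A$). -/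

import Mathlib

/-!
Statement 0: Refining a `G/H`-grading of a crossed product to a `G`-grading.

Let `k` be a commutative ring, `G` a group with a normal subgroup `H`, and `A` a
`k`-algebra with a `G/H`-grading `𝒜` making `A` a crossed product, with identity
component `B := 𝒜 1`.  Suppose `B` carries an `H`-grading `ℬ` making it a crossed
product with identity component `C := ℬ 1`.  Given invertible elements `a x ∈ 𝒜 x̄`
(`x ∈ G`) such that (1) `a h ∈ ℬ h` for `h ∈ H`, (2) `aₓ C aₓ⁻¹ = C`, and
(3) `aₓ a_y a_{xy}⁻¹ ∈ C^×`, the family `𝒞 x := C ⬝ aₓ` is a `G`-grading of `A`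
refining the `G/H`-grading, with `𝒞 h = ℬ h` for `h ∈ H`, and makes `A` a
`G`-crossed product.
-/

open scoped Classical in
theorem statement0
    (k : Type*) [CommRing k] (G : Type*) [Group G] (H : Subgroup G) [H.Normal]
    (A : Type*) [Ring A] [Algebra k A]
    -- the G/H-grading of A, a crossed product:
    (𝒜 : G ⧸ H → Submodule k A)
    (hAinternal : DirectSum.IsInternal 𝒜)
    (hAone : (1 : A) ∈ 𝒜 1)
    (hAmul : ∀ g h : G ⧸ H, 𝒜 g * 𝒜 h ≤ 𝒜 (g * h))
    (hAcross : ∀ g : G ⧸ H, ∃ u : Aˣ, (u : A) ∈ 𝒜 g)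
    -- the H-grading of B = 𝒜 1, a crossed product:
    (ℬ : H → Submodule k A)
    (hBindep : iSupIndep ℬ)
    (hBsup : (⨆ h : H, ℬ h) = 𝒜 1)
    (hBone : (1 : A) ∈ ℬ 1)
    (hBmul : ∀ h h' : H, ℬ h * ℬ h' ≤ ℬ (h * h'))
    (hBcross : ∀ h : H, ∃ u : Aˣ, (u : A) ∈ ℬ h)
    -- the family of homogeneous units:
    (a : G → Aˣ)
    (hadeg : ∀ x : G, (a x : A) ∈ 𝒜 (x : G ⧸ H))
    -- (1) a h ∈ B_h for h ∈ H:
    (h1 : ∀ h : H, (a h : A) ∈ ℬ h)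
    -- (2) aₓ C aₓ⁻¹ = C for all x ∈ G:
    (h2 : ∀ x : G, Submodule.map
        ((LinearMap.mulRight k ((a x)⁻¹ : Aˣ).val).comp (LinearMap.mulLeft k (a x : A)))
        (ℬ 1) = ℬ 1)
    -- (3) aₓ a_y a_{xy}⁻¹ ∈ C^× for all x, y ∈ G:
    (h3 : ∀ x y : G, ((a x * a y * (a (x * y))⁻¹ : Aˣ) : A) ∈ ℬ 1 ∧
        (((a x * a y * (a (x * y))⁻¹)⁻¹ : Aˣ) : A) ∈ ℬ 1) :
    -- Conclusions, with 𝒞 x := C ⬝ aₓ :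
    let 𝒞 : G → Submodule k A :=
      fun x => Submodule.map (LinearMap.mulRight k (a x : A)) (ℬ 1)
    -- 𝒞 is a G-grading of A:
    DirectSum.IsInternal 𝒞 ∧
    (∀ x y : G, 𝒞 x * 𝒞 y ≤ 𝒞 (x * y)) ∧
    ((1 : A) ∈ 𝒞 1) ∧
    -- it refines the G/H-grading:
    (∀ gq : G ⧸ H, 𝒜 gq = ⨆ x : G, ⨆ _ : (x : G ⧸ H) = gq, 𝒞 x) ∧
    -- it satisfies 𝒞 h = ℬ h for h ∈ H:
    (∀ h : H, 𝒞 (h : G) = ℬ h) ∧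
    -- and it makes A a G-crossed product:
    (∀ x : G, ∃ u : Aˣ, (u : A) ∈ 𝒞 x) := by
  intro 𝒞
  have mem𝒞 : ∀ (x : G) (z : A), z ∈ 𝒞 x ↔ z * ((a x)⁻¹ : Aˣ) ∈ ℬ 1 := by
    intro x z
    constructor
    · rintro ⟨c, hc, rfl⟩
      simpa [mul_assoc] using hc
    · intro h
      exact ⟨_, h, by simp [mul_assoc]⟩
  have Cmul : ∀ {u v : A}, u ∈ ℬ 1 → v ∈ ℬ 1 → u * v ∈ ℬ 1 := by
    intro u v hu hv
    have := hBmul 1 1 (Submodule.mul_mem_mul hu hv)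
    rwa [mul_one] at this
  have conj : ∀ (x : G) {c : A}, c ∈ ℬ 1 → (a x : A) * c * ((a x)⁻¹ : Aˣ) ∈ ℬ 1 := by
    intro x c hc
    have : ((LinearMap.mulRight k ((a x)⁻¹ : Aˣ).val).comp (LinearMap.mulLeft k (a x : A))) c
        ∈ ℬ 1 := by
      rw [← h2 x]
      exact Submodule.mem_map_of_mem hc
    simpa using this
  have ha1 : (a 1 : A) ∈ ℬ 1 := by simpa using (h3 1 1).1
  have ha1' : (((a 1)⁻¹ : Aˣ) : A) ∈ ℬ 1 := by simpa using (h3 1 1).2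
  -- translation
  have trans : ∀ (x y : G) (z : A), z ∈ 𝒞 (x * y) ↔ z * ((a y)⁻¹ : Aˣ) ∈ 𝒞 x := by
    intro x y z
    rw [mem𝒞, mem𝒞]
    constructor
    · intro h
      have := Cmul h (h3 x y).2
      simpa [mul_assoc] using this
    · intro h
      have := Cmul h (h3 x y).1
      simpa [mul_assoc] using this
  have one𝒞 : (1 : A) ∈ 𝒞 1 := by rw [mem𝒞]; simpa using ha1'
  -- the inverse of a x
  have ainv : ∀ x : G, ∃ c ∈ ℬ 1, (((a x)⁻¹ : Aˣ) : A) = a x⁻¹ * c := by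
    intro x
    refine ⟨_, Cmul ha1' (h3 x x⁻¹).2, ?_⟩
    rw [← Units.val_mul, ← Units.val_mul]
    congr 1
    simp [mul_assoc]
  have hCB : ∀ h : H, 𝒞 (h : G) = ℬ h := by
    intro h
    apply le_antisymm
    · rintro _ ⟨c, hc, rfl⟩
      have := hBmul 1 h (Submodule.mul_mem_mul hc (h1 h))
      rwa [one_mul] at this
    · intro b hb
      rw [mem𝒞]
      obtain ⟨c, hc, e⟩ := ainv h
      rw [e, ← mul_assoc]
      have e1 := hBmul _ _ (Submodule.mul_mem_mul hb (h1 h⁻¹))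
      rw [mul_inv_cancel] at e1
      exact Cmul e1 hc
  have hC𝒜 : ℬ 1 ≤ 𝒜 1 := hBsup ▸ le_iSup ℬ 1
  have h𝒞𝒜 : ∀ x : G, 𝒞 x ≤ 𝒜 (x : G ⧸ H) := by
    rintro x _ ⟨c, hc, rfl⟩
    have := hAmul _ _ (Submodule.mul_mem_mul (hC𝒜 hc) (hadeg x))
    rwa [one_mul] at this
  have h𝒜inv : ∀ (x : G) (z : A), z ∈ 𝒜 (x : G ⧸ H) → z * ((a x)⁻¹ : Aˣ) ∈ 𝒜 1 := by
    intro x z hz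
    obtain ⟨c, hc, e⟩ := ainv x
    rw [e]
    have e1 := hAmul _ _ (Submodule.mul_mem_mul hz
      (hAmul _ _ (Submodule.mul_mem_mul (hadeg x⁻¹) (hC𝒜 hc))))
    rwa [mul_one, QuotientGroup.mk_inv, mul_inv_cancel] at e1
  have hcoset : ∀ (h : H) (x : G), (((h : G) * x : G) : G ⧸ H) = x := by
    intro h x
    rw [QuotientGroup.mk_mul, (QuotientGroup.eq_one_iff (h : G)).2 h.2, one_mul]
  have hrefine : ∀ gq : G ⧸ H, 𝒜 gq = ⨆ x : G, ⨆ _ : (x : G ⧸ H) = gq, 𝒞 x := by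
    intro gq
    apply le_antisymm
    · obtain ⟨x, rfl⟩ := QuotientGroup.mk_surjective gq
      intro z hz
      have hz' := h𝒜inv x z hz
      rw [← hBsup] at hz'
      have e := Submodule.mem_map_of_mem (f := LinearMap.mulRight k (a x : A)) hz'
      rw [Submodule.map_iSup] at e
      have e0 : LinearMap.mulRight k (a x : A) (z * ((a x)⁻¹ : Aˣ)) = z := by
        simp [mul_assoc]
      rw [e0] at e
      refine SetLike.le_def.1 (iSup_le fun h => ?_) e
      refine le_trans ?_ (le_iSup₂_of_le ((h : G) * x) (hcoset h x) le_rfl)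
      rintro _ ⟨b, hb, rfl⟩
      rw [trans, hCB]
      simpa [mul_assoc] using hb
    · refine iSup₂_le ?_
      rintro x rfl
      exact h𝒞𝒜 x
  have hmul : ∀ x y : G, 𝒞 x * 𝒞 y ≤ 𝒞 (x * y) := by
    intro x y
    rw [Submodule.mul_le]
    rintro _ ⟨c, hc, rfl⟩ _ ⟨d, hd, rfl⟩
    rw [mem𝒞]
    have := Cmul (Cmul hc (conj x hd)) (h3 x y).1
    simpa [mul_assoc] using this
  obtain ⟨hAind, hAtop⟩ :=
    (DirectSum.isInternal_submodule_iff_iSupIndep_and_iSup_eq_top 𝒜).1 hAinternal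
  have hind : iSupIndep 𝒞 := by
    rw [iSupIndep_iff_finsetSum_eq_zero_imp_eq_zero] at hAind hBindep ⊢
    intro s v hv hs x hx
    have hfib : ∑ y ∈ s with QuotientGroup.mk (s := H) y = (x : G ⧸ H), v y = 0 := by
      refine hAind (s.image (fun y : G => (y : G ⧸ H)))
        (fun q => ∑ y ∈ s with QuotientGroup.mk (s := H) y = q, v y) ?_ ?_ x (Finset.mem_image_of_mem _ hx)
      · intro q _
        refine Submodule.sum_mem _ fun y hy => ?_
        rw [Finset.mem_filter] at hy
        rw [← hy.2]
        exact h𝒞𝒜 y (hv y hy.1)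
      · rw [← hs]
        exact Finset.sum_fiberwise_of_maps_to (fun y hy => Finset.mem_image_of_mem _ hy) v
    have hinj : Function.Injective (fun h : H => (h : G) * x) := by
      intro h h' e
      exact Subtype.ext (mul_right_cancel e)
    have key := hBindep (s.preimage (fun h : H => (h : G) * x) hinj.injOn)
      (fun h => v ((h : G) * x) * ((a x)⁻¹ : Aˣ)) ?_ ?_ 1 (by simpa using hx)
    · simpa using key
    · intro h hh
      rw [← hCB, ← trans]
      exact hv _ (by simpa using hh)
    · rw [← Finset.sum_mul]
      have : ∑ h ∈ s.preimage (fun h : H => (h : G) * x) hinj.injOn, v ((h : G) * x)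
          = ∑ y ∈ s with QuotientGroup.mk (s := H) y = (x : G ⧸ H), v y := by
        refine Finset.sum_nbij (fun h : H => (h : G) * x) ?_ hinj.injOn ?_ (fun _ _ => rfl)
        · intro h hh
          rw [Finset.mem_filter]
          exact ⟨by simpa using hh, hcoset h x⟩
        · intro y hy
          have hy' := Finset.mem_filter.1 (Finset.mem_coe.1 hy)
          have hm : y * x⁻¹ ∈ H := by
            rw [← QuotientGroup.eq_one_iff, QuotientGroup.mk_mul, hy'.2, QuotientGroup.mk_inv,
              mul_inv_cancel]
          exact ⟨⟨y * x⁻¹, hm⟩, by simpa using hy'.1, by simp⟩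
      rw [this, hfib, zero_mul]
  have htop : iSup 𝒞 = ⊤ := by
    rw [eq_top_iff, ← hAtop]
    refine iSup_le fun q => ?_
    rw [hrefine q]
    exact iSup₂_le fun x _ => le_iSup 𝒞 x
  refine ⟨DirectSum.isInternal_submodule_of_iSupIndep_of_iSup_eq_top hind htop, hmul, one𝒞,
    hrefine, hCB, fun x => ⟨a x, ?_⟩⟩
  rw [mem𝒞]
  simpa using hBone
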